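/- Let p be a prime number and let A be an abelian group such that every element of A has order a power of p and the p-torsion subgroup A[p] is finite. Then the Tate module T_p(A) := Hom_ℤ(ℚ_p/ℤ_p, A), equipped with the ℤ_p-module structure given by precomposition with the ℤ_p-scalar multiplication on ℚ_p/ℤ_p, is a free ℤ_p-module of finite rank. -/

import Mathlib

/-- The Prüfer `p`-group `ℚ_p/ℤ_p`: the quotient of the additive group of the `p`-adic
numbers by the additive subgroup given by the `p`-adic integers. -/
noncomputable def PadicQuotient (p : ℕ) [Fact p.Prime] : Type :=
  ℚ_[p] ⧸ (LinearMap.range (Algebra.linearMap ℤ_[p] ℚ_[p]))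

noncomputable instance (p : ℕ) [Fact p.Prime] : AddCommGroup (PadicQuotient p) :=
  inferInstanceAs (AddCommGroup (ℚ_[p] ⧸ (LinearMap.range (Algebra.linearMap ℤ_[p] ℚ_[p]))))

noncomputable instance (p : ℕ) [Fact p.Prime] : Module ℤ_[p] (PadicQuotient p) :=
  inferInstanceAs (Module ℤ_[p] (ℚ_[p] ⧸ (LinearMap.range (Algebra.linearMap ℤ_[p] ℚ_[p]))))

/-- The `ℤ_p`-module structure on the Tate module `T_p(A) = Hom_ℤ(ℚ_p/ℤ_p, A)`, given by
precomposition with the `ℤ_p`-scalar multiplication on `ℚ_p/ℤ_p`: `(c • φ) x = φ (c • x)`. -/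
noncomputable instance TateModule.module (p : ℕ) [Fact p.Prime] (A : Type*) [AddCommGroup A] :
    Module ℤ_[p] (PadicQuotient p →+ A) where
  smul c φ := φ.comp (DistribMulAction.toAddMonoidHom (PadicQuotient p) c)
  one_smul φ := by
    ext x
    show φ ((1 : ℤ_[p]) • x) = φ x
    rw [one_smul]
  mul_smul c d φ := by
    ext x
    show φ ((c * d) • x) = φ (d • c • x)
    rw [mul_comm, mul_smul]
  smul_zero c := rfl
  smul_add c φ ψ := rfl
  add_smul c d φ := by
    ext x
    show φ ((c + d) • x) = φ (c • x) + φ (d • x)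
    rw [add_smul, map_add]
  zero_smul φ := by
    ext x
    show φ ((0 : ℤ_[p]) • x) = 0
    rw [zero_smul, map_zero]

theorem IsPrecomplete.pi_span_singleton {R : Type*} [CommRing R] (r : R)
    [IsPrecomplete (Ideal.span {r}) R] (ι : Type*) :
    IsPrecomplete (Ideal.span {r}) (ι → R) where
  prec' f hf := by
    simp only [SModEq.sub_mem, Ideal.span_singleton_pow, Submodule.ideal_span_singleton_smul,
      Submodule.mem_smul_pointwise_iff_exists, Submodule.mem_top, true_and] at hf ⊢
    have key (i : ι) : ∃ L : R, ∀ n, ∃ y : R, r ^ n • y = f n i - L := by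
      obtain ⟨L, hL⟩ := IsPrecomplete.prec (I := Ideal.span {r}) ‹_› (f := fun n ↦ f n i) <| by
        intro m n hmn
        obtain ⟨y, hy⟩ := hf hmn
        simp only [SModEq.sub_mem, Ideal.span_singleton_pow, Submodule.ideal_span_singleton_smul,
          Submodule.mem_smul_pointwise_iff_exists, Submodule.mem_top, true_and]
        exact ⟨y i, congrFun hy i⟩
      simp only [SModEq.sub_mem, Ideal.span_singleton_pow, Submodule.ideal_span_singleton_smul,
        Submodule.mem_smul_pointwise_iff_exists, Submodule.mem_top, true_and] at hL
      exact ⟨L, hL⟩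
    choose L y hy using key
    exact ⟨L, fun n ↦ ⟨fun i ↦ y i n, funext fun i ↦ hy i n⟩⟩

theorem Module.Finite.of_isHausdorff_of_finite_quotient {R M : Type*} [CommRing R]
    [AddCommGroup M] [Module R M] (r : R) [IsPrecomplete (Ideal.span {r}) R]
    [IsHausdorff (Ideal.span {r}) M]
    [Finite (M ⧸ (Ideal.span {r} • ⊤ : Submodule R M))] : Module.Finite R M := by
  classical
  let Q := M ⧸ (Ideal.span {r} • ⊤ : Submodule R M)
  have := Fintype.ofFinite Q
  have := IsPrecomplete.pi_span_singleton r Q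
  have hsurj : Function.Surjective (Fintype.linearCombination R (Quotient.out : Q → M)) := by
    apply surjective_of_mkQ_comp_surjective (I := Ideal.span {r})
    intro q
    refine ⟨Pi.single q 1, ?_⟩
    rw [LinearMap.comp_apply, Fintype.linearCombination_apply_single, one_smul]
    exact Quotient.out_eq q
  exact Module.Finite.of_surjective _ hsurj

namespace PadicQuotient

variable (p : ℕ) [Fact p.Prime]

/-- The projection `ℚ_p → ℚ_p/ℤ_p`. -/
noncomputable def mk : ℚ_[p] →ₗ[ℤ_[p]] PadicQuotient p :=
  (LinearMap.range (Algebra.linearMap ℤ_[p] ℚ_[p])).mkQ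

theorem mk_surjective : Function.Surjective (mk p) :=
  Submodule.mkQ_surjective _

variable {p}

theorem mk_eq_zero {q : ℚ_[p]} : mk p q = 0 ↔ ∃ z : ℤ_[p], (z : ℚ_[p]) = q :=
  (Submodule.Quotient.mk_eq_zero _).trans LinearMap.mem_range

theorem smul_surjective {c : ℤ_[p]} (hc : c ≠ 0) :
    Function.Surjective (fun x : PadicQuotient p ↦ c • x) := by
  intro x
  obtain ⟨q, rfl⟩ := mk_surjective p x
  have hc' : (c : ℚ_[p]) ≠ 0 := by simpa using hc
  refine ⟨mk p ((c : ℚ_[p])⁻¹ * q), ?_⟩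
  dsimp only
  rw [← map_smul, Algebra.smul_def, PadicInt.algebraMap_apply, mul_inv_cancel_left₀ hc']

theorem exists_pow_smul_eq_zero (x : PadicQuotient p) : ∃ n : ℕ, (p : ℤ_[p]) ^ n • x = 0 := by
  obtain ⟨q, rfl⟩ := mk_surjective p x
  obtain ⟨n, hn⟩ := pow_unbounded_of_one_lt ‖q‖
    (show (1 : ℝ) < p from mod_cast (Fact.out : p.Prime).one_lt)
  have hp : (0 : ℝ) < (p : ℝ) ^ n := pow_pos (mod_cast (Fact.out : p.Prime).pos) n
  have hnorm : ‖(p : ℚ_[p]) ^ n * q‖ ≤ 1 := by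
    rw [norm_mul, norm_pow, Padic.norm_p, inv_pow, inv_mul_le_iff₀ hp, mul_one]
    exact hn.le
  refine ⟨n, ?_⟩
  rw [← map_smul, mk_eq_zero]
  refine ⟨⟨_, hnorm⟩, ?_⟩
  rw [Algebra.smul_def, PadicInt.algebraMap_apply]
  push_cast
  rfl

theorem smul_mk_inv : (p : ℤ_[p]) • mk p (p : ℚ_[p])⁻¹ = 0 := by
  have hp : (p : ℚ_[p]) ≠ 0 := mod_cast (Fact.out : p.Prime).ne_zero
  rw [← map_smul, mk_eq_zero]
  refine ⟨1, ?_⟩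
  rw [Algebra.smul_def, PadicInt.algebraMap_apply]
  simp [hp]

theorem exists_nsmul_mk_inv_of_smul_eq_zero {x : PadicQuotient p} (hx : (p : ℤ_[p]) • x = 0) :
    ∃ n : ℕ, x = n • mk p (p : ℚ_[p])⁻¹ := by
  have hp : (p : ℚ_[p]) ≠ 0 := mod_cast (Fact.out : p.Prime).ne_zero
  obtain ⟨q, rfl⟩ := mk_surjective p x
  rw [← map_smul, mk_eq_zero] at hx
  obtain ⟨z, hz⟩ := hx
  rw [Algebra.smul_def, PadicInt.algebraMap_apply, PadicInt.coe_natCast] at hz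
  obtain ⟨w, hw⟩ := Ideal.mem_span_singleton.mp (PadicInt.appr_spec 1 z)
  refine ⟨z.appr 1, ?_⟩
  have hq : mk p q = z • mk p (p : ℚ_[p])⁻¹ := by
    rw [← map_smul, Algebra.smul_def, PadicInt.algebraMap_apply, hz]
    congr 1
    field_simp
  rw [pow_one, sub_eq_iff_eq_add] at hw
  rw [hq]
  nth_rewrite 1 [hw]
  rw [add_smul, mul_comm, mul_smul, smul_mk_inv, smul_zero, zero_add, Nat.cast_smul_eq_nsmul]

end PadicQuotient

namespace TateModule

variable {p : ℕ} [Fact p.Prime] {A : Type*} [AddCommGroup A]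

theorem smul_apply (c : ℤ_[p]) (φ : PadicQuotient p →+ A) (x : PadicQuotient p) :
    (c • φ) x = φ (c • x) :=
  rfl

instance isTorsionFree : Module.IsTorsionFree ℤ_[p] (PadicQuotient p →+ A) where
  isSMulRegular c hc φ ψ h := by
    ext x
    obtain ⟨y, rfl⟩ := PadicQuotient.smul_surjective hc.ne_zero x
    exact DFunLike.congr_fun h y

instance isHausdorff :
    IsHausdorff (Ideal.span {(p : ℤ_[p])}) (PadicQuotient p →+ A) where
  haus' φ h := by
    ext x
    obtain ⟨n, hn⟩ := PadicQuotient.exists_pow_smul_eq_zero x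
    have hφ := h n
    rw [SModEq.zero, Ideal.span_singleton_pow, Submodule.ideal_span_singleton_smul,
      Submodule.mem_smul_pointwise_iff_exists] at hφ
    obtain ⟨ψ, -, rfl⟩ := hφ
    rw [smul_apply, hn, map_zero, AddMonoidHom.zero_apply]

theorem exists_smul_eq_of_apply_eq_zero {φ : PadicQuotient p →+ A}
    (hφ : φ (PadicQuotient.mk p (p : ℚ_[p])⁻¹) = 0) :
    ∃ ψ : PadicQuotient p →+ A, (p : ℤ_[p]) • ψ = φ := by
  let m := DistribSMul.toAddMonoidHom (PadicQuotient p) (p : ℤ_[p])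
  have hm : Function.Surjective m :=
    PadicQuotient.smul_surjective (mod_cast (Fact.out : p.Prime).ne_zero)
  have hker : m.ker ≤ φ.ker := by
    intro x hx
    obtain ⟨n, rfl⟩ := PadicQuotient.exists_nsmul_mk_inv_of_smul_eq_zero hx
    rw [AddMonoidHom.mem_ker, map_nsmul, hφ, nsmul_zero]
  refine ⟨m.liftOfSurjective hm ⟨φ, hker⟩, ?_⟩
  ext x
  exact AddMonoidHom.liftOfRightInverse_comp_apply m _ (Function.rightInverse_surjInv hm)
    ⟨φ, hker⟩ x

theorem finite_quotient (hfin : {a : A | p • a = 0}.Finite) :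
    Finite ((PadicQuotient p →+ A) ⧸
      (Ideal.span {(p : ℤ_[p])} • ⊤ : Submodule ℤ_[p] (PadicQuotient p →+ A))) := by
  have := hfin.to_subtype
  have hmem (φ : PadicQuotient p →+ A) :
      φ (PadicQuotient.mk p (p : ℚ_[p])⁻¹) ∈ {a : A | p • a = 0} := by
    rw [Set.mem_ofPred_eq, ← map_nsmul, ← Nat.cast_smul_eq_nsmul ℤ_[p],
      PadicQuotient.smul_mk_inv, map_zero]
  refine Finite.of_injective (β := {a : A | p • a = 0}) (fun q ↦ ⟨_, hmem q.out⟩) ?_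
  intro q₁ q₂ h
  obtain ⟨ψ, hψ⟩ := exists_smul_eq_of_apply_eq_zero (φ := q₁.out - q₂.out) <| by
    rw [AddMonoidHom.sub_apply, sub_eq_zero]
    exact congrArg Subtype.val h
  rw [← Quotient.out_eq q₁, ← Quotient.out_eq q₂]
  refine (Submodule.Quotient.eq _).mpr ?_
  rw [← hψ]
  exact Submodule.smul_mem_smul (Ideal.mem_span_singleton_self _) Submodule.mem_top

end TateModule

/-- if `A` is a `p`-primary abelian group with finite `p`-torsion subgroup `A[p]`,
then the Tate module `T_p(A) = Hom_ℤ(ℚ_p/ℤ_p, A)` is a free `ℤ_p`-module of finite rank. -/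
theorem statement1 (p : ℕ) [Fact p.Prime] (A : Type*) [AddCommGroup A]
    (horder : ∀ a : A, ∃ n : ℕ, p ^ n • a = 0)
    (hfin : {a : A | p • a = 0}.Finite) :
    Module.Free ℤ_[p] (PadicQuotient p →+ A) ∧
      Module.Finite ℤ_[p] (PadicQuotient p →+ A) := by
  have : IsAdicComplete (Ideal.span {(p : ℤ_[p])}) ℤ_[p] := by
    rw [← PadicInt.maximalIdeal_eq_span_p]
    infer_instance
  have := TateModule.finite_quotient hfin
  have : Module.Finite ℤ_[p] (PadicQuotient p →+ A) :=
    Module.Finite.of_isHausdorff_of_finite_quotient (p : ℤ_[p])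
  exact ⟨inferInstance, this⟩
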